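/- For every integer t ≥ 0 and every t-dominating graph G, there is a subset X ⊆ V(G) with |X| ≥ |V(G)|/2 such that either the subgraph of G induced on X has maximum degree at most 2t, or the complement of the subgraph of G induced on X has maximum degree at most 2t. -/

import Mathlib

/-- `u` `t`-dominates `v` in `G`: there are at most `t` vertices different from `u, v`
that are adjacent to `v` and not to `u`. -/
def Dominates {V : Type*} (G : SimpleGraph V) (t : ℕ) (u v : V) : Prop :=
  {w : V | w ≠ u ∧ w ≠ v ∧ G.Adj w v ∧ ¬ G.Adj w u}.ncard ≤ t

/-- `G` is `t`-dominating: for every pair of distinct vertices, one `t`-dominates the other. -/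
def IsTDominating {V : Type*} (G : SimpleGraph V) (t : ℕ) : Prop :=
  ∀ u v : V, u ≠ v → Dominates G t u v ∨ Dominates G t v u

open Finset in
/-- In a `t`-dominating graph, a vertex `t`-dominates every vertex of at most its degree. -/
theorem IsTDominating.dominates_of_degree_le {V : Type*} [Fintype V] {t : ℕ} {G : SimpleGraph V}
    [DecidableRel G.Adj] (hG : IsTDominating G t) {u v : V} (h : G.degree v ≤ G.degree u) :
    Dominates G t u v := by
  classical
  rcases eq_or_ne u v with rfl | huv
  · simp [Dominates]
  rcases hG u v huv with h' | h'
  · exact h'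
  have dominated_eq_sdiff : ∀ a b : V, {w : V | w ≠ a ∧ w ≠ b ∧ G.Adj w b ∧ ¬ G.Adj w a} =
      ((((G.neighborFinset b).erase a) \ ((G.neighborFinset a).erase b) : Finset V) : Set V) := by
    intro a b
    ext w
    have : G.Adj w b → w ≠ b := fun e => e.ne
    simp only [Set.mem_ofPred_eq, coe_sdiff, coe_erase, Set.mem_sdiff, Set.mem_singleton_iff,
      SetLike.mem_coe, SimpleGraph.mem_neighborFinset, G.adj_comm a w, G.adj_comm b w]
    tauto
  have card_le : #((G.neighborFinset v).erase u) ≤ #((G.neighborFinset u).erase v) := by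
    simp only [card_erase_eq_ite, SimpleGraph.mem_neighborFinset, G.adj_comm v u,
      SimpleGraph.card_neighborFinset_eq_degree]
    split_ifs <;> omega
  unfold Dominates at h' ⊢
  rw [dominated_eq_sdiff, Set.ncard_coe_finset] at h' ⊢
  exact (card_sdiff_le_card_sdiff_iff.2 card_le).trans h'

/-- Every natural-valued function on a finite type has a median. -/
theorem exists_nat_median {V : Type*} [Fintype V] (f : V → ℕ) :
    ∃ d, Fintype.card V ≤ 2 * {v | d ≤ f v}.ncard ∧ Fintype.card V ≤ 2 * {v | f v ≤ d}.ncard := by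
  classical
  have ex : ∃ d, Fintype.card V ≤ 2 * {v | f v ≤ d}.ncard := by
    refine ⟨Finset.univ.sup f, ?_⟩
    have : {v | f v ≤ Finset.univ.sup f} = Set.univ :=
      Set.eq_univ_of_forall fun v => show f v ≤ _ from Finset.le_sup (Finset.mem_univ v)
    rw [this, Set.ncard_univ, Nat.card_eq_fintype_card]
    omega
  refine ⟨Nat.find ex, ?_, Nat.find_spec ex⟩
  rcases hd : Nat.find ex with _ | d
  · simp only [zero_le, Set.ofPred_true, Set.ncard_univ, Nat.card_eq_fintype_card]
    omega
  · have hlt : ¬ Fintype.card V ≤ 2 * {v | f v ≤ d}.ncard := Nat.find_min ex (by omega)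
    have hcompl : {v | d + 1 ≤ f v} = {v | f v ≤ d}ᶜ := by
      ext v; simp
    have := Set.ncard_add_ncard_compl {v | f v ≤ d}
    rw [← hcompl, Nat.card_eq_fintype_card] at this
    omega

open Finset in
/-- If every vertex of `A` `t`-dominates every vertex of `B`, then a vertex of `A` with more than
`2 * t` non-neighbours in `A` excludes a vertex of `B` with more than `2 * t` neighbours in `B`. -/
theorem ncard_neighbors_le_or_ncard_nonneighbors_le {V : Type*} [Finite V] {t : ℕ}
    {G : SimpleGraph V} {A B : Set V} (hAB : ∀ x ∈ A, ∀ y ∈ B, Dominates G t x y) {a b : V}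
    (ha : a ∈ A) (hb : b ∈ B) :
    {y : V | y ∈ B ∧ G.Adj b y}.ncard ≤ 2 * t ∨
      {x : V | x ∈ A ∧ x ≠ a ∧ ¬ G.Adj a x}.ncard ≤ 2 * t := by
  classical
  have := Fintype.ofFinite V
  by_contra! hcon
  obtain ⟨hq, hp⟩ := hcon
  rw [Set.ncard_eq_toFinset_card'] at hq hp
  set P := {x : V | x ∈ A ∧ x ≠ a ∧ ¬ G.Adj a x}.toFinset
  set Q := {y : V | y ∈ B ∧ G.Adj b y}.toFinset
  have mem_P : ∀ x, x ∈ P ↔ x ∈ A ∧ x ≠ a ∧ ¬ G.Adj a x := fun x => Set.mem_toFinset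
  have mem_Q : ∀ y, y ∈ Q ↔ y ∈ B ∧ G.Adj b y := fun y => Set.mem_toFinset
  have card_le : ∀ (S : Finset V) (x y : V), x ∈ A → y ∈ B →
      (∀ w ∈ S, w ≠ x ∧ G.Adj w y ∧ ¬ G.Adj w x) → #S ≤ t := by
    intro S x y hx hy hS
    rw [← Set.ncard_coe_finset]
    refine (Set.ncard_le_ncard (fun w hw => ?_) (Set.toFinite _)).trans (hAB x hx y hy)
    obtain ⟨h1, h2, h3⟩ := hS w hw
    exact ⟨h1, h2.ne, h2, h3⟩
  have adj_le : #{z ∈ P ×ˢ Q | G.Adj z.1 z.2} ≤ #Q * t := by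
    rw [card_filter, sum_product_right, ← smul_eq_mul]
    refine sum_le_card_nsmul _ _ _ fun y hy => ?_
    rw [← card_filter]
    refine card_le _ a y ha ((mem_Q y).1 hy).1 fun w hw => ?_
    rw [mem_filter, mem_P] at hw
    exact ⟨hw.1.2.1, hw.2, fun e => hw.1.2.2 e.symm⟩
  have nonadj_le : #{z ∈ P ×ˢ Q | z.1 ≠ z.2 ∧ ¬ G.Adj z.1 z.2} ≤ #P * t := by
    rw [card_filter, sum_product, ← smul_eq_mul]
    refine sum_le_card_nsmul _ _ _ fun x hx => ?_
    rw [← card_filter]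
    refine card_le _ x b ((mem_P x).1 hx).1 hb fun w hw => ?_
    rw [mem_filter, mem_Q] at hw
    exact ⟨hw.2.1.symm, hw.1.2.symm, fun e => hw.2.2 e.symm⟩
  have eq_le : #{z ∈ P ×ˢ Q | z.1 = z.2} ≤ t := by
    have hinter : #(P ∩ Q) ≤ t := by
      refine card_le _ a b ha hb fun w hw => ?_
      rw [mem_inter, mem_P, mem_Q] at hw
      exact ⟨hw.1.2.1, hw.2.2.symm, fun e => hw.1.2.2 e.symm⟩
    refine (card_le_card_of_injOn Prod.fst ?_ ?_).trans hinter
    · rintro ⟨x, y⟩ hz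
      simp only [coe_filter, mem_product, Set.mem_ofPred_eq] at hz
      obtain ⟨⟨hx, hy⟩, rfl⟩ := hz
      simp [hx, hy]
    · rintro ⟨x, y⟩ hz ⟨x', y'⟩ hz' h
      simp only [coe_filter, mem_product, Set.mem_ofPred_eq] at hz hz' h
      simp [← hz.2, ← hz'.2, h]
  have cover : P ×ˢ Q ⊆ ({z ∈ P ×ˢ Q | G.Adj z.1 z.2} ∪
      {z ∈ P ×ˢ Q | z.1 ≠ z.2 ∧ ¬ G.Adj z.1 z.2}) ∪ {z ∈ P ×ˢ Q | z.1 = z.2} := by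
    intro z hz
    simp only [mem_union, mem_filter, hz, true_and]
    tauto
  have total := card_le_card cover
  rw [card_product] at total
  have h1 := card_union_le ({z ∈ P ×ˢ Q | G.Adj z.1 z.2} ∪
      {z ∈ P ×ˢ Q | z.1 ≠ z.2 ∧ ¬ G.Adj z.1 z.2}) {z ∈ P ×ˢ Q | z.1 = z.2}
  have h2 := card_union_le {z ∈ P ×ˢ Q | G.Adj z.1 z.2}
      {z ∈ P ×ˢ Q | z.1 ≠ z.2 ∧ ¬ G.Adj z.1 z.2}
  have bound : #P * #Q ≤ #Q * t + #P * t + t := by omega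
  have hpq : (2 * t + 1) * #Q ≤ #P * #Q := Nat.mul_le_mul_right _ hp
  have hqp : #P * (2 * t + 1) ≤ #P * #Q := Nat.mul_le_mul_left _ hq
  nlinarith

theorem statement_17 {V : Type*} [Fintype V] (t : ℕ) (G : SimpleGraph V)
    (hG : IsTDominating G t) :
    ∃ X : Set V, Fintype.card V ≤ 2 * X.ncard ∧
      ((∀ x ∈ X, {y : V | y ∈ X ∧ G.Adj x y}.ncard ≤ 2 * t) ∨
       (∀ x ∈ X, {y : V | y ∈ X ∧ y ≠ x ∧ ¬ G.Adj x y}.ncard ≤ 2 * t)) := by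
  classical
  obtain ⟨d, hA, hB⟩ := exists_nat_median fun v => G.degree v
  have hAB : ∀ x ∈ {v | d ≤ G.degree v}, ∀ y ∈ {v | G.degree v ≤ d}, Dominates G t x y :=
    fun x hx y hy => hG.dominates_of_degree_le (le_trans hy hx)
  by_cases hsparse : ∀ x ∈ {v | G.degree v ≤ d},
      {y : V | y ∈ {v | G.degree v ≤ d} ∧ G.Adj x y}.ncard ≤ 2 * t
  · exact ⟨_, hB, Or.inl hsparse⟩
  · push Not at hsparse
    obtain ⟨b, hb, hdeg⟩ := hsparse
    exact ⟨_, hA, Or.inr fun a ha =>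
      (ncard_neighbors_le_or_ncard_nonneighbors_le hAB ha hb).resolve_left hdeg.not_ge⟩
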